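/- Let d ≥ 2, q ≥ 2, α > d, J > 0, β > 0, and let φ : ZMod q → ℝ have all Fourier coefficients nonnegative reals. Let f : (ℤ^d → ZMod q) → ℝ be a local function, i.e. there is a finite Λ₀ ⊂ ℤ^d such that f(σ) depends only on the restriction σ|_{Λ₀}. Then for every r ∈ ZMod q there exists L ∈ ℝ such that the net Λ ↦ ⟨f⟩^r_{Λ,β} := ∑_{σ∈Ω_Λ^r} f(σ)·μ^r_{Λ,β}(σ), indexed by the finite subsets Λ of ℤ^d directed by inclusion, converges to L (along the atTop filter on Finset (ℤ^d)). -/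

import Mathlib

open scoped BigOperators
open Filter

noncomputable section

/-- The lattice `ℤ^d`. -/
abbrev Zd (d : ℕ) := Fin d → ℤ

/-- The ℓ¹-norm on `ℤ^d`. -/
def l1 {d : ℕ} (x : Zd d) : ℤ := ∑ i, |x i|

/-- Long-range couplings `J_{xy} = J / |x-y|^α` for `x ≠ y`, and `J_{xx} = 0`. -/
noncomputable def Jcoup (d : ℕ) (J α : ℝ) (x y : Zd d) : ℝ :=
  if x = y then 0 else J / ((l1 (x - y) : ℝ) ^ α)

/-- The configuration in `Ω_Λ^r` determined by `σ : Λ → ZMod q`. -/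
def extendCfg {d q : ℕ} (Λ : Finset (Zd d)) (r : ZMod q) (σ : Λ → ZMod q) :
    Zd d → ZMod q :=
  fun x => if hx : x ∈ Λ then σ ⟨x, hx⟩ else r

/-- The Hamiltonian `H^r_Λ(σ)` with monochromatic boundary condition `r`. -/
noncomputable def ham (d q : ℕ) (J α : ℝ) (φ : ZMod q → ℝ) (Λ : Finset (Zd d))
    (r : ZMod q) (σ : Zd d → ZMod q) : ℝ :=
  -(1 / 2) * (∑ x ∈ Λ, ∑ y ∈ Λ, Jcoup d J α x y * φ (σ x - σ y))
    - ∑ x ∈ Λ, ∑' y : Zd d, (if y ∈ Λ then 0 else Jcoup d J α x y * φ (σ x - r))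

/-- Gibbs weight: the probability `μ^r_{Λ,β}(σ)` of the configuration `σ`. -/
noncomputable def gibbsWeight (d q : ℕ) [NeZero q] (J α β : ℝ) (φ : ZMod q → ℝ)
    (Λ : Finset (Zd d)) (r : ZMod q) (σ : Λ → ZMod q) : ℝ :=
  Real.exp (-(β * ham d q J α φ Λ r (extendCfg Λ r σ)))
    / ∑ ω : Λ → ZMod q, Real.exp (-(β * ham d q J α φ Λ r (extendCfg Λ r ω)))

/-- The `k`-th Fourier coefficient of `f : ZMod q → ℝ`. -/
noncomputable def ftZMod {q : ℕ} [NeZero q] (f : ZMod q → ℝ) (k : ZMod q) : ℂ :=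
  ∑ n : ZMod q, (f n : ℂ) *
    Complex.exp (-(2 * (Real.pi : ℝ) * Complex.I * ((k.val * n.val : ℕ) : ℂ)) / (q : ℂ))

section Ginibre

variable {A : Type*}

/-- Finite sums of kernels `(p, m) ↦ F p * F m`. -/
inductive IsSquareSum : (A → A → ℝ) → Prop
  | sq (F : A → ℝ) : IsSquareSum fun p m => F p * F m
  | add {K L : A → A → ℝ} (hK : IsSquareSum K) (hL : IsSquareSum L) :
      IsSquareSum fun p m => K p m + L p m

namespace IsSquareSum

theorem const {c : ℝ} (hc : 0 ≤ c) : IsSquareSum fun _ _ : A => c := by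
  simpa [Real.mul_self_sqrt hc] using sq (fun _ : A => √c)

theorem mul {K L : A → A → ℝ} (hK : IsSquareSum K) (hL : IsSquareSum L) :
    IsSquareSum fun p m => K p m * L p m := by
  induction hK with
  | sq F =>
    induction hL with
    | sq G =>
      convert sq (fun a => F a * G a) using 3
      ring
    | add _ _ h₁ h₂ => simpa only [mul_add] using h₁.add h₂
  | add _ _ h₁ h₂ => simpa only [add_mul] using h₁.add h₂

theorem smul {c : ℝ} (hc : 0 ≤ c) {K : A → A → ℝ} (hK : IsSquareSum K) :
    IsSquareSum fun p m => c * K p m :=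
  (const hc).mul hK

theorem pow {K : A → A → ℝ} (hK : IsSquareSum K) (n : ℕ) :
    IsSquareSum fun p m => K p m ^ n := by
  induction n with
  | zero => simpa using const (A := A) zero_le_one
  | succ n ih => simpa only [pow_succ] using ih.mul hK

theorem sum_nonneg [AddCommGroup A] [Fintype A] {K : A → A → ℝ} (hK : IsSquareSum K) :
    0 ≤ ∑ σ : A, ∑ τ : A, K (σ + τ) (σ - τ) := by
  induction hK with
  | add _ _ h₁ h₂ => simpa only [Finset.sum_add_distrib] using add_nonneg h₁ h₂
  | sq F =>
    set G : A → ℝ := fun m => ∑ τ, F (m + τ + τ)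
    have hG (m τ : A) : G (m + τ + τ) = G m := by
      refine Fintype.sum_equiv (Equiv.addLeft τ) _ _ fun x => congrArg F ?_
      simp only [Equiv.coe_addLeft]
      abel
    have h₁ : ∑ σ : A, ∑ τ : A, F (σ + τ) * F (σ - τ) = ∑ m, G m * F m := by
      rw [Finset.sum_comm]
      simp only [G, Finset.sum_mul]
      rw [Finset.sum_comm (s := Finset.univ (α := A)) (f := fun m τ => F (m + τ + τ) * F m)]
      refine Finset.sum_congr rfl fun τ _ => ?_
      refine Fintype.sum_equiv (Equiv.subRight τ) _ _ fun x => ?_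
      simp
    have h₂ (τ : A) : ∑ m, G m * F m = ∑ m, G m * F (m + τ + τ) := by
      symm
      refine Fintype.sum_equiv ((Equiv.addRight τ).trans (Equiv.addRight τ)) _ _ fun x => ?_
      simp [hG]
    have h₃ : (Fintype.card A : ℝ) * ∑ m, G m * F m = ∑ m, G m * G m := by
      rw [← nsmul_eq_mul, ← Finset.card_univ, ← Finset.sum_const,
        Finset.sum_congr rfl fun τ _ => h₂ τ, Finset.sum_comm]
      simp only [← Finset.mul_sum, G]
    rw [h₁]
    have : 0 < (Fintype.card A : ℝ) := by exact_mod_cast Fintype.card_pos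
    refine nonneg_of_mul_nonneg_right ?_ this
    rw [h₃]
    exact Finset.sum_nonneg fun m _ => mul_self_nonneg _

end IsSquareSum

variable [AddCommGroup A]

/-- Functions whose duplicated sum and difference are, up to sign, sums of squares in the
variables `σ + τ` and `σ - τ`. -/
structure IsGinibre (f : A → ℝ) : Prop where
  add : ∃ K, IsSquareSum K ∧ ∀ σ τ, f σ + f τ = K (σ + τ) (σ - τ)
  sub : ∃ K, IsSquareSum K ∧ ∀ σ τ, f τ - f σ = K (σ + τ) (σ - τ)

namespace IsGinibre

theorem const {c : ℝ} (hc : 0 ≤ c) : IsGinibre fun _ : A => c where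
  add := ⟨_, .const (add_nonneg hc hc), fun _ _ => rfl⟩
  sub := ⟨_, .const le_rfl, fun _ _ => sub_self _⟩

theorem fun_add {f g : A → ℝ} (hf : IsGinibre f) (hg : IsGinibre g) :
    IsGinibre fun a => f a + g a := by
  obtain ⟨⟨K, hK, hK'⟩, ⟨L, hL, hL'⟩⟩ := hf
  obtain ⟨⟨M, hM, hM'⟩, ⟨N, hN, hN'⟩⟩ := hg
  refine ⟨⟨_, hK.add hM, fun σ τ => ?_⟩, ⟨_, hL.add hN, fun σ τ => ?_⟩⟩
  · rw [← hK', ← hM']; ring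
  · rw [← hL', ← hN']; ring

theorem fun_mul {f g : A → ℝ} (hf : IsGinibre f) (hg : IsGinibre g) :
    IsGinibre fun a => f a * g a := by
  obtain ⟨⟨K, hK, hK'⟩, ⟨L, hL, hL'⟩⟩ := hf
  obtain ⟨⟨M, hM, hM'⟩, ⟨N, hN, hN'⟩⟩ := hg
  have h2 : (0 : ℝ) ≤ 1 / 2 := by norm_num
  refine ⟨⟨_, ((hK.mul hM).add (hL.mul hN)).smul h2, fun σ τ => ?_⟩,
    ⟨_, ((hL.mul hM).add (hK.mul hN)).smul h2, fun σ τ => ?_⟩⟩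
  all_goals rw [← hK', ← hM', ← hL', ← hN']; ring

theorem const_mul {c : ℝ} (hc : 0 ≤ c) {f : A → ℝ} (hf : IsGinibre f) :
    IsGinibre fun a => c * f a :=
  (const hc).fun_mul hf

theorem sum {ι : Type*} {s : Finset ι} {f : ι → A → ℝ} (h : ∀ i ∈ s, IsGinibre (f i)) :
    IsGinibre fun a => ∑ i ∈ s, f i a := by
  classical
  induction s using Finset.induction_on with
  | empty => simpa using const (A := A) le_rfl
  | insert i s hi ih =>
    simp only [Finset.sum_insert hi]
    exact (h i (by simp)).fun_add (ih fun j hj => h j (by simp [hj]))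

theorem prod {ι : Type*} {s : Finset ι} {f : ι → A → ℝ} (h : ∀ i ∈ s, IsGinibre (f i)) :
    IsGinibre fun a => ∏ i ∈ s, f i a := by
  classical
  induction s using Finset.induction_on with
  | empty => simpa using const (A := A) zero_le_one
  | insert i s hi ih =>
    simp only [Finset.prod_insert hi]
    exact (h i (by simp)).fun_mul (ih fun j hj => h j (by simp [hj]))

/-- The real part of the square of a unitary character. -/
theorem re_sq {ψ : AddChar A ℂ} (hψ : ∀ a, ψ (-a) = starRingEnd ℂ (ψ a)) :
    IsGinibre fun a => (ψ a ^ 2).re := by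
  have hn (a : A) : (ψ a).re * (ψ a).re + (ψ a).im * (ψ a).im = 1 := by
    have h : ψ a * ψ (-a) = 1 := by rw [← AddChar.map_add_eq_mul]; simp
    rw [hψ, Complex.mul_conj, Complex.normSq_apply] at h
    exact_mod_cast h
  refine ⟨⟨_, (IsSquareSum.sq fun a => (ψ a).re).smul zero_le_two, fun σ τ => ?_⟩,
    ⟨_, (IsSquareSum.sq fun a => (ψ a).im).smul zero_le_two, fun σ τ => ?_⟩⟩
  all_goals
    simp only [sub_eq_add_neg, AddChar.map_add_eq_mul, hψ, pow_two, Complex.mul_re,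
      Complex.mul_im, Complex.conj_re, Complex.conj_im]
    have h₁ := hn σ
    have h₂ := hn τ
    generalize (ψ σ).re = a at *
    generalize (ψ σ).im = b at *
    generalize (ψ τ).re = c at *
    generalize (ψ τ).im = d at *
  · linear_combination (-(c * c) + d * d) * h₁ + (- (a * a) + b * b) * h₂
  · linear_combination (-(c * c) + d * d) * h₁ + ((a * a) - b * b) * h₂

variable [Fintype A]

/-- **Ginibre's inequality**: positive correlation of two Ginibre functions. -/
theorem correlation {f g h : A → ℝ} (hf : IsGinibre f) (hg : IsGinibre g) (hh : IsGinibre h) :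
    (∑ a, f a * Real.exp (h a)) * ∑ a, g a * Real.exp (h a) ≤
      (∑ a, Real.exp (h a)) * ∑ a, f a * g a * Real.exp (h a) := by
  have key : 0 ≤ ∑ σ : A, ∑ τ : A,
      (f τ - f σ) * (g τ - g σ) * Real.exp (h σ + h τ) := by
    have hlim : Tendsto (fun n : ℕ => ∑ σ : A, ∑ τ : A,
        (f τ - f σ) * (g τ - g σ) * (1 + (h σ + h τ) / n) ^ n) atTop
        (nhds (∑ σ : A, ∑ τ : A, (f τ - f σ) * (g τ - g σ) * Real.exp (h σ + h τ))) :=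
      tendsto_finsetSum _ fun σ _ => tendsto_finsetSum _ fun τ _ =>
        (Real.tendsto_one_add_div_pow_exp _).const_mul _
    refine ge_of_tendsto' hlim fun n => ?_
    obtain ⟨F, hF, hF'⟩ := hf.sub
    obtain ⟨G, hG, hG'⟩ := hg.sub
    obtain ⟨H, hH, hH'⟩ := hh.add
    have hn : (0 : ℝ) ≤ (n : ℝ)⁻¹ := by positivity
    simp only [hF', hG', hH', div_eq_inv_mul]
    exact ((hF.mul hG).mul
      (((IsSquareSum.const zero_le_one).add (hH.smul hn)).pow n)).sum_nonneg
  have expand : ∑ σ : A, ∑ τ : A, (f τ - f σ) * (g τ - g σ) * Real.exp (h σ + h τ) =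
      2 * ((∑ a, Real.exp (h a)) * ∑ a, f a * g a * Real.exp (h a)) -
      2 * ((∑ a, f a * Real.exp (h a)) * ∑ a, g a * Real.exp (h a)) := by
    have e (σ τ : A) : (f τ - f σ) * (g τ - g σ) * Real.exp (h σ + h τ) =
        Real.exp (h σ) * (f τ * g τ * Real.exp (h τ)) +
        f σ * g σ * Real.exp (h σ) * Real.exp (h τ) -
        (f σ * Real.exp (h σ) * (g τ * Real.exp (h τ)) +
          g σ * Real.exp (h σ) * (f τ * Real.exp (h τ))) := by
      rw [Real.exp_add]; ring
    simp only [e, Finset.sum_add_distrib, Finset.sum_sub_distrib, ← Finset.mul_sum,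
      ← Finset.sum_mul]
    ring
  linarith

end IsGinibre

end Ginibre

section Lift

variable {d q : ℕ}

/-- Reduction modulo `q` of residues modulo `2 * q`; characters acquire a square root on the
larger group. -/
def redMod (q : ℕ) : ZMod (2 * q) →+* ZMod q :=
  ZMod.castHom (dvd_mul_left q 2) (ZMod q)

theorem stdAddChar_redMod [NeZero q] (m : ZMod (2 * q)) :
    (ZMod.stdAddChar (redMod q m) : ℂ) = ZMod.stdAddChar m ^ 2 := by
  obtain ⟨j, rfl⟩ := ZMod.intCast_surjective m
  rw [map_intCast, ZMod.stdAddChar_coe, ZMod.stdAddChar_coe, ← Complex.exp_nat_mul]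
  congr 1
  have : (q : ℂ) ≠ 0 := by exact_mod_cast NeZero.ne q
  push_cast
  field_simp

theorem stdAddChar_neg [NeZero q] (m : ZMod q) :
    (ZMod.stdAddChar (-m) : ℂ) = starRingEnd ℂ (ZMod.stdAddChar m) := by
  rw [AddChar.map_neg_eq_conj]

theorem isGinibre_stdAddChar [NeZero q] {A : Type*} [AddCommGroup A] (l : A →+ ZMod (2 * q)) :
    IsGinibre fun a => (ZMod.stdAddChar (redMod q (l a)) : ℂ).re := by
  simp only [stdAddChar_redMod]
  exact IsGinibre.re_sq (ψ := (ZMod.stdAddChar (N := 2 * q)).compAddMonoidHom l) fun a => by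
    simp [stdAddChar_neg]

theorem ftZMod_eq_dft [NeZero q] (φ : ZMod q → ℝ) (k : ZMod q) :
    ftZMod φ k = ZMod.dft (fun n => (φ n : ℂ)) k := by
  rw [ZMod.dft_apply, ftZMod]
  refine Finset.sum_congr rfl fun n _ => ?_
  rw [smul_eq_mul, mul_comm]
  congr 1
  have h : -(n * k) = ((-(k.val * n.val : ℕ) : ℤ) : ZMod q) := by
    push_cast
    simp [mul_comm]
  rw [h, ZMod.stdAddChar_coe]
  congr 1
  push_cast
  ring

theorem eq_sum_ftZMod [NeZero q] {φ : ZMod q → ℝ} (hφ : ∀ k, (ftZMod φ k).im = 0) (n : ZMod q) :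
    φ n = (q : ℝ)⁻¹ * ∑ k, (ftZMod φ k).re * (ZMod.stdAddChar (k * n) : ℂ).re := by
  have h := congrFun (ZMod.dft.symm_apply_apply fun n => (φ n : ℂ)) n
  rw [ZMod.invDFT_apply] at h
  have h' := congrArg Complex.re h
  rw [Complex.ofReal_re, smul_eq_mul, ← Complex.ofReal_natCast, ← Complex.ofReal_inv,
    Complex.re_ofReal_mul, Complex.re_sum] at h'
  rw [← h']
  congr 1
  refine Finset.sum_congr rfl fun k _ => ?_
  rw [smul_eq_mul, Complex.mul_re, ← ftZMod_eq_dft, hφ k]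
  ring

theorem even_of_ftZMod_real [NeZero q] {φ : ZMod q → ℝ} (hφ : ∀ k, (ftZMod φ k).im = 0)
    (n : ZMod q) : φ (-n) = φ n := by
  rw [eq_sum_ftZMod hφ, eq_sum_ftZMod hφ n]
  simp [stdAddChar_neg]

theorem isGinibre_of_ftZMod [NeZero q] {φ : ZMod q → ℝ}
    (hφ : ∀ k, 0 ≤ (ftZMod φ k).re ∧ (ftZMod φ k).im = 0)
    {A : Type*} [AddCommGroup A] (l : A →+ ZMod (2 * q)) :
    IsGinibre fun a => φ (redMod q (l a)) := by
  simp only [eq_sum_ftZMod fun k => (hφ k).2]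
  refine .const_mul (by positivity) (.sum fun k _ => .const_mul (hφ k).1 ?_)
  convert isGinibre_stdAddChar ((AddMonoidHom.mulLeft (k.val : ZMod (2 * q))).comp l) using 5
  simp

theorem isGinibre_indicator_zero [NeZero q] {A : Type*} [AddCommGroup A]
    (l : A →+ ZMod (2 * q)) :
    IsGinibre fun a => if redMod q (l a) = 0 then (1 : ℝ) else 0 := by
  refine isGinibre_of_ftZMod (φ := fun n => if n = 0 then 1 else 0) (fun k => ?_) l
  simp [ftZMod]

/-- The value at `x` of a field on `Λ`, extended by zero. -/
def fieldAt (q : ℕ) (Λ : Finset (Zd d)) (x : Zd d) : (Λ → ZMod (2 * q)) →+ ZMod (2 * q) :=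
  if hx : x ∈ Λ then Pi.evalAddMonoidHom _ ⟨x, hx⟩ else 0

/-- The configuration in `Ω_Λ^r` obtained by shifting the reduction of a field on `Λ`. -/
def liftCfg (Λ : Finset (Zd d)) (r : ZMod q) (a : Λ → ZMod (2 * q)) : Zd d → ZMod q :=
  fun x => r + redMod q (fieldAt q Λ x a)

theorem liftCfg_eq_extendCfg (Λ : Finset (Zd d)) (r : ZMod q) (a : Λ → ZMod (2 * q)) :
    liftCfg Λ r a = extendCfg Λ r fun x => r + redMod q (a x) := by
  ext x
  by_cases hx : x ∈ Λ <;> simp [liftCfg, extendCfg, fieldAt, hx]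

theorem exists_sum_liftCfg [NeZero q] (Λ : Finset (Zd d)) (r : ZMod q) :
    ∃ c : ℝ, 0 < c ∧ ∀ F : (Zd d → ZMod q) → ℝ,
      ∑ a, F (liftCfg Λ r a) = c * ∑ σ : Λ → ZMod q, F (extendCfg Λ r σ) := by
  classical
  set p : (Λ → ZMod (2 * q)) → Λ → ZMod q := fun a x => r + redMod q (a x) with hp
  have hsurj : Function.Surjective p := fun σ => by
    choose b hb using fun x => ZMod.castHom_surjective (dvd_mul_left q 2) (σ x - r)
    exact ⟨b, funext fun x => (congrArg (r + ·) (hb x)).trans (add_sub_cancel r (σ x))⟩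
  have hcard (σ : Λ → ZMod q) :
      (Finset.univ.filter fun a => p a = σ).card =
        (Finset.univ.filter fun a => p a = fun _ => r).card := by
    obtain ⟨b, rfl⟩ := hsurj σ
    refine Finset.card_nbij' (fun a => a - b) (fun a => a + b) ?_ ?_ ?_ ?_ <;> intro a ha
    · simpa [hp, funext_iff, sub_eq_zero] using ha
    · simpa [hp, funext_iff] using ha
    · simp
    · simp
  refine ⟨(Finset.univ.filter fun a => p a = fun _ => r).card, ?_, fun F => ?_⟩
  · exact_mod_cast Finset.card_pos.2 ⟨0, by simp [hp]⟩
  · simp only [liftCfg_eq_extendCfg]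
    rw [← Finset.sum_fiberwise Finset.univ p, Finset.mul_sum]
    refine Finset.sum_congr rfl fun σ _ => ?_
    rw [← hcard σ, ← nsmul_eq_mul, ← Finset.sum_const]
    exact Finset.sum_congr rfl fun a ha => by rw [← (Finset.mem_filter.1 ha).2]

/-- Configurations in `Ω_Λ^r` are those of `Ω_Λ'^r` equal to `r` on `Λ' \ Λ`. -/
theorem sum_extendCfg_eq_sum_indicator [NeZero q] {Λ Λ' : Finset (Zd d)} (h : Λ ⊆ Λ')
    (r : ZMod q) (F : (Zd d → ZMod q) → ℝ) :
    ∑ σ : Λ → ZMod q, F (extendCfg Λ r σ) =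
      ∑ σ : Λ' → ZMod q, F (extendCfg Λ' r σ) *
        ∏ x ∈ Λ' \ Λ, if extendCfg Λ' r σ x - r = 0 then 1 else 0 := by
  have hext (σ : Λ → ZMod q) :
      extendCfg Λ' r (fun x : Λ' => extendCfg Λ r σ x) = extendCfg Λ r σ := by
    ext x
    by_cases hx : x ∈ Λ'
    · simp [extendCfg, hx]
    · have : x ∉ Λ := fun hx' => hx (h hx')
      simp [extendCfg, hx, this]
  refine Finset.sum_of_injOn (fun σ (x : Λ') => extendCfg Λ r σ x) ?_ (by simp) ?_ ?_
  · intro σ _ τ _ hστ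
    ext ⟨x, hx⟩
    simpa [extendCfg, hx] using congrFun hστ ⟨x, h hx⟩
  · intro σ _ hσ
    refine mul_eq_zero_of_right _ (Finset.prod_eq_zero_iff.2 ?_)
    by_contra! hne
    refine hσ ⟨fun x => σ ⟨x, h x.2⟩, by simp, ?_⟩
    ext ⟨x, hx⟩
    by_cases hx' : x ∈ Λ
    · simp [extendCfg, hx']
    · have := hne x (Finset.mem_sdiff.2 ⟨hx, hx'⟩)
      simp only [extendCfg, hx, dif_pos, ne_eq, ite_eq_right_iff, one_ne_zero, imp_false,
        not_not, sub_eq_zero] at this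
      simp [extendCfg, hx', this]
  · intro σ _
    rw [hext, Finset.prod_eq_one, mul_one]
    intro x hx
    simp [extendCfg, (Finset.mem_sdiff.1 hx).2]

end Lift

section Hamiltonian

variable {d q : ℕ} {J α : ℝ}

theorem Jcoup_comm (x y : Zd d) : Jcoup d J α x y = Jcoup d J α y x := by
  have h : l1 (x - y) = l1 (y - x) := by simp [l1, abs_sub_comm]
  simp only [Jcoup, h, eq_comm (a := x)]

theorem l1_nonneg (x : Zd d) : 0 ≤ l1 x := Finset.sum_nonneg fun _ _ => abs_nonneg _

theorem Jcoup_nonneg (hJ : 0 ≤ J) (x y : Zd d) : 0 ≤ Jcoup d J α x y := by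
  unfold Jcoup
  split_ifs
  · exact le_rfl
  · exact div_nonneg hJ (Real.rpow_nonneg (by exact_mod_cast l1_nonneg _) _)

theorem norm_le_l1 (x : Zd d) : ‖x‖ ≤ (l1 x : ℝ) := by
  refine (pi_norm_le_iff_of_nonneg (by exact_mod_cast l1_nonneg x)).2 fun i => ?_
  rw [Int.norm_eq_abs]
  exact_mod_cast Finset.single_le_sum (f := fun i => |x i|) (fun _ _ => abs_nonneg _)
    (Finset.mem_univ i)

theorem summable_Zd_norm_rpow (hα : (d : ℝ) < α) : Summable fun x : Zd d => ‖x‖ ^ (-α) := by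
  let b := Pi.basisFun ℝ (Fin d)
  let L := Submodule.span ℤ (Set.range b)
  have hL : Module.finrank ℤ L = d := by
    rw [ZLattice.rank ℝ L, Module.finrank_fin_fun]
  have hsum := ZLattice.summable_norm_rpow L (-α) (by rw [hL]; linarith)
  let e : Zd d → L := fun x => ⟨fun i => (x i : ℝ),
    (b.mem_span_iff_repr_mem ℤ _).2 fun i => ⟨x i, by simp [b]⟩⟩
  have he : Function.Injective e := fun x y h => by
    ext i
    exact Int.cast_injective (α := ℝ) (congrFun (congrArg Subtype.val h) i)
  refine (hsum.comp_injective he).congr fun x => ?_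
  have : ‖e x‖ = ‖x‖ := by
    simp only [e, Submodule.coe_norm, Pi.norm_def]
    congr
  rw [Function.comp_apply, this]

theorem summable_Jcoup (hα : (d : ℝ) < α) (hJ : 0 ≤ J) (x : Zd d) :
    Summable fun y => Jcoup d J α x y := by
  have h := ((Equiv.subLeft x).summable_iff.2 (summable_Zd_norm_rpow hα)).mul_left J
  refine Summable.of_nonneg_of_le (Jcoup_nonneg hJ x) (fun y => ?_) h
  simp only [Function.comp, Equiv.subLeft_apply]
  unfold Jcoup
  split_ifs with hxy
  · positivity
  · have hpos : 0 < ‖x - y‖ := norm_pos_iff.2 (sub_ne_zero.2 hxy)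
    have hα' : 0 ≤ α := (Nat.cast_nonneg d).trans hα.le
    rw [Real.rpow_neg hpos.le, ← div_eq_mul_inv]
    gcongr
    exact norm_le_l1 _

/-- The total coupling between `x` and the complement of `Λ`. -/
def boundaryCoupling (J α : ℝ) (Λ : Finset (Zd d)) (x : Zd d) : ℝ :=
  ∑' y : Zd d, if y ∈ Λ then 0 else Jcoup d J α x y

theorem boundaryCoupling_nonneg (hJ : 0 ≤ J) (Λ : Finset (Zd d)) (x : Zd d) :
    0 ≤ boundaryCoupling J α Λ x :=
  tsum_nonneg fun y => by split_ifs <;> simp [Jcoup_nonneg hJ]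

theorem boundaryCoupling_eq_add_sum (hα : (d : ℝ) < α) (hJ : 0 ≤ J) {Λ Λ' : Finset (Zd d)}
    (h : Λ ⊆ Λ') (x : Zd d) :
    boundaryCoupling J α Λ x =
      boundaryCoupling J α Λ' x + ∑ y ∈ Λ' \ Λ, Jcoup d J α x y := by
  have hs (S : Finset (Zd d)) :
      boundaryCoupling J α S x = ∑' y, Jcoup d J α x y - ∑ y ∈ S, Jcoup d J α x y := by
    have h₁ := (summable_Jcoup hα hJ x).sum_add_tsum_subtype_compl S
    rw [← h₁, add_sub_cancel_left, boundaryCoupling]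
    refine Eq.trans ?_ (tsum_subtype {y | y ∉ S} fun y => Jcoup d J α x y).symm
    refine tsum_congr fun y => ?_
    by_cases hy : y ∈ S <;> simp [hy]
  rw [hs, hs, ← Finset.sum_sdiff h]
  ring

theorem ham_eq (φ : ZMod q → ℝ) (Λ : Finset (Zd d)) (r : ZMod q) (σ : Zd d → ZMod q) :
    ham d q J α φ Λ r σ =
      -(1 / 2) * (∑ x ∈ Λ, ∑ y ∈ Λ, Jcoup d J α x y * φ (σ x - σ y)) -
        ∑ x ∈ Λ, boundaryCoupling J α Λ x * φ (σ x - r) := by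
  unfold ham boundaryCoupling
  congr 1
  refine Finset.sum_congr rfl fun x _ => ?_
  rw [← tsum_mul_right]
  exact tsum_congr fun y => by split_ifs <;> simp

/-- Freezing the spins in `Λ' \ Λ` changes the Hamiltonian by a constant. -/
theorem exists_ham_eq_ham_add (hα : (d : ℝ) < α) (hJ : 0 ≤ J) {φ : ZMod q → ℝ}
    (hφ : ∀ n, φ (-n) = φ n) {Λ Λ' : Finset (Zd d)} (h : Λ ⊆ Λ') (r : ZMod q) :
    ∃ C, ∀ σ : Zd d → ZMod q, (∀ x ∉ Λ, σ x = r) →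
      ham d q J α φ Λ' r σ = ham d q J α φ Λ r σ + C := by
  refine ⟨-(1 / 2) * (∑ x ∈ Λ' \ Λ, ∑ y ∈ Λ' \ Λ, Jcoup d J α x y * φ 0) -
    ∑ x ∈ Λ' \ Λ, boundaryCoupling J α Λ' x * φ 0, fun σ hσ => ?_⟩
  have hD {x : Zd d} (hx : x ∈ Λ' \ Λ) : σ x = r := hσ x (Finset.mem_sdiff.1 hx).2
  have hDD : ∑ x ∈ Λ' \ Λ, ∑ y ∈ Λ' \ Λ, Jcoup d J α x y * φ (σ x - σ y) =
      ∑ x ∈ Λ' \ Λ, ∑ y ∈ Λ' \ Λ, Jcoup d J α x y * φ 0 :=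
    Finset.sum_congr rfl fun x hx => Finset.sum_congr rfl fun y hy => by
      rw [hD hx, hD hy, sub_self]
  have hΛD : ∑ x ∈ Λ, ∑ y ∈ Λ' \ Λ, Jcoup d J α x y * φ (σ x - σ y) =
      ∑ x ∈ Λ, (∑ y ∈ Λ' \ Λ, Jcoup d J α x y) * φ (σ x - r) :=
    Finset.sum_congr rfl fun x _ => by
      rw [Finset.sum_mul]
      exact Finset.sum_congr rfl fun y hy => by rw [hD hy]
  have hDΛ : ∑ x ∈ Λ' \ Λ, ∑ y ∈ Λ, Jcoup d J α x y * φ (σ x - σ y) =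
      ∑ x ∈ Λ, (∑ y ∈ Λ' \ Λ, Jcoup d J α x y) * φ (σ x - r) := by
    rw [Finset.sum_comm, ← hΛD]
    refine Finset.sum_congr rfl fun x _ => Finset.sum_congr rfl fun y _ => ?_
    rw [Jcoup_comm, ← hφ, neg_sub]
  have hb : ∑ x ∈ Λ' \ Λ, boundaryCoupling J α Λ' x * φ (σ x - r) =
      ∑ x ∈ Λ' \ Λ, boundaryCoupling J α Λ' x * φ 0 :=
    Finset.sum_congr rfl fun x hx => by rw [hD hx, sub_self]
  have hbΛ : ∑ x ∈ Λ, boundaryCoupling J α Λ x * φ (σ x - r) =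
      ∑ x ∈ Λ, boundaryCoupling J α Λ' x * φ (σ x - r) +
        ∑ x ∈ Λ, (∑ y ∈ Λ' \ Λ, Jcoup d J α x y) * φ (σ x - r) := by
    rw [← Finset.sum_add_distrib]
    exact Finset.sum_congr rfl fun x _ => by
      rw [boundaryCoupling_eq_add_sum hα hJ h, add_mul]
  rw [ham_eq, ham_eq, hbΛ, ← Finset.sum_sdiff h, ← Finset.sum_sdiff (s₁ := Λ) (s₂ := Λ') h]
  simp only [← Finset.sum_sdiff (s₁ := Λ) (s₂ := Λ') h, Finset.sum_add_distrib]
  rw [hDD, hΛD, hDΛ, hb]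
  ring

theorem isGinibre_neg_ham [NeZero q] {β : ℝ} (hJ : 0 ≤ J) (hβ : 0 ≤ β) {φ : ZMod q → ℝ}
    (hφ : ∀ k, 0 ≤ (ftZMod φ k).re ∧ (ftZMod φ k).im = 0) (Λ : Finset (Zd d)) (r : ZMod q) :
    IsGinibre fun a : Λ → ZMod (2 * q) => -(β * ham d q J α φ Λ r (liftCfg Λ r a)) := by
  have h₁ : IsGinibre fun a : Λ → ZMod (2 * q) => ∑ x ∈ Λ, ∑ y ∈ Λ,
      Jcoup d J α x y * φ (redMod q ((fieldAt q Λ x - fieldAt q Λ y) a)) :=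
    .sum fun x _ => .sum fun y _ => .const_mul (Jcoup_nonneg hJ x y) (isGinibre_of_ftZMod hφ _)
  have h₂ : IsGinibre fun a : Λ → ZMod (2 * q) => ∑ x ∈ Λ,
      boundaryCoupling J α Λ x * φ (redMod q (fieldAt q Λ x a)) :=
    .sum fun x _ => .const_mul (boundaryCoupling_nonneg hJ Λ x) (isGinibre_of_ftZMod hφ _)
  convert (h₁.const_mul (c := β / 2) (by positivity)).fun_add (h₂.const_mul hβ) using 2 with a
  rw [ham_eq]
  simp only [liftCfg, add_sub_add_left_eq_sub, add_sub_cancel_left, AddMonoidHom.sub_apply,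
    map_sub]
  ring

theorem ham_liftCfg_neg {φ : ZMod q → ℝ} (hφ : ∀ n, φ (-n) = φ n) (Λ : Finset (Zd d))
    (r : ZMod q) (a : Λ → ZMod (2 * q)) :
    ham d q J α φ Λ r (liftCfg Λ r (-a)) = ham d q J α φ Λ r (liftCfg Λ r a) := by
  have h (x y : Zd d) : liftCfg Λ r (-a) x - liftCfg Λ r (-a) y =
      -(liftCfg Λ r a x - liftCfg Λ r a y) := by
    simp only [liftCfg, map_neg]; ring
  have h' (x : Zd d) : liftCfg Λ r (-a) x - r = -(liftCfg Λ r a x - r) := by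
    simp [liftCfg]
  simp only [ham_eq, h, h', hφ]

end Hamiltonian

section Mean

variable {d q : ℕ} [NeZero q] {J α β : ℝ} {φ : ZMod q → ℝ} {r : ZMod q}

/-- The expectation `⟨F⟩^r_{Λ,β}`. -/
def gibbsMean (J α β : ℝ) (φ : ZMod q → ℝ) (Λ : Finset (Zd d)) (r : ZMod q)
    (F : (Zd d → ZMod q) → ℝ) : ℝ :=
  ∑ σ : Λ → ZMod q, F (extendCfg Λ r σ) * gibbsWeight d q J α β φ Λ r σ

theorem gibbsMean_eq_div (Λ : Finset (Zd d)) (F : (Zd d → ZMod q) → ℝ) :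
    gibbsMean J α β φ Λ r F =
      (∑ σ : Λ → ZMod q, F (extendCfg Λ r σ) *
        Real.exp (-(β * ham d q J α φ Λ r (extendCfg Λ r σ)))) /
      ∑ σ : Λ → ZMod q, Real.exp (-(β * ham d q J α φ Λ r (extendCfg Λ r σ))) := by
  rw [Finset.sum_div]
  exact Finset.sum_congr rfl fun σ _ => (mul_div_assoc _ _ _).symm

theorem gibbsMean_eq_div_lift (Λ : Finset (Zd d)) (F : (Zd d → ZMod q) → ℝ) :
    gibbsMean J α β φ Λ r F =
      (∑ a, F (liftCfg Λ r a) * Real.exp (-(β * ham d q J α φ Λ r (liftCfg Λ r a)))) /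
      ∑ a, Real.exp (-(β * ham d q J α φ Λ r (liftCfg Λ r a))) := by
  obtain ⟨c, hc, h⟩ := exists_sum_liftCfg Λ r
  rw [h fun σ => F σ * Real.exp (-(β * ham d q J α φ Λ r σ)),
    h fun σ => Real.exp (-(β * ham d q J α φ Λ r σ)), mul_div_mul_left _ _ hc.ne',
    gibbsMean_eq_div]

/-- Expectations in `Λ` are conditional expectations in `Λ'` given that the spins in `Λ' \ Λ`
equal `r`. -/
theorem gibbsMean_eq_div_conditioned (hα : (d : ℝ) < α) (hJ : 0 ≤ J)
    (hφ : ∀ n, φ (-n) = φ n) {Λ Λ' : Finset (Zd d)} (h : Λ ⊆ Λ') (F : (Zd d → ZMod q) → ℝ) :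
    gibbsMean J α β φ Λ r F =
      (∑ a, F (liftCfg Λ' r a) * (∏ x ∈ Λ' \ Λ, if liftCfg Λ' r a x - r = 0 then 1 else 0) *
        Real.exp (-(β * ham d q J α φ Λ' r (liftCfg Λ' r a)))) /
      ∑ a, (∏ x ∈ Λ' \ Λ, if liftCfg Λ' r a x - r = 0 then 1 else 0) *
        Real.exp (-(β * ham d q J α φ Λ' r (liftCfg Λ' r a))) := by
  obtain ⟨c, hc, hlift⟩ := exists_sum_liftCfg Λ' r
  obtain ⟨C, hC⟩ := exists_ham_eq_ham_add hα hJ hφ h r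
  have key (G : (Zd d → ZMod q) → ℝ) :
      ∑ a, G (liftCfg Λ' r a) * (∏ x ∈ Λ' \ Λ, if liftCfg Λ' r a x - r = 0 then 1 else 0) *
        Real.exp (-(β * ham d q J α φ Λ' r (liftCfg Λ' r a))) =
      c * Real.exp (-(β * C)) * ∑ σ : Λ → ZMod q, G (extendCfg Λ r σ) *
        Real.exp (-(β * ham d q J α φ Λ r (extendCfg Λ r σ))) := by
    rw [hlift fun σ => G σ * (∏ x ∈ Λ' \ Λ, if σ x - r = 0 then 1 else 0) *
      Real.exp (-(β * ham d q J α φ Λ' r σ)), mul_assoc]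
    congr 1
    have e := sum_extendCfg_eq_sum_indicator h r fun σ =>
      G σ * Real.exp (-(β * ham d q J α φ Λ' r σ))
    simp only [mul_right_comm] at e ⊢
    rw [← e, Finset.mul_sum]
    refine Finset.sum_congr rfl fun σ _ => ?_
    rw [hC _ fun x hx => by simp [extendCfg, hx], mul_add, neg_add, Real.exp_add]
    ring
  have key₁ := key fun _ => 1
  simp only [one_mul] at key₁
  rw [key, key₁, mul_div_mul_left _ _ (mul_pos hc (Real.exp_pos _)).ne', gibbsMean_eq_div]

theorem antitone_gibbsMean (hα : (d : ℝ) < α) (hJ : 0 ≤ J) (hβ : 0 ≤ β)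
    (hφ : ∀ k, 0 ≤ (ftZMod φ k).re ∧ (ftZMod φ k).im = 0) {F : (Zd d → ZMod q) → ℝ}
    (hF : ∀ Λ : Finset (Zd d), IsGinibre fun a : Λ → ZMod (2 * q) => F (liftCfg Λ r a)) :
    Antitone fun Λ : Finset (Zd d) => gibbsMean J α β φ Λ r F := by
  intro Λ Λ' h
  simp only
  rw [gibbsMean_eq_div_conditioned hα hJ (even_of_ftZMod_real fun k => (hφ k).2) h,
    gibbsMean_eq_div_lift Λ']
  have hI : IsGinibre fun a : Λ' → ZMod (2 * q) =>
      ∏ x ∈ Λ' \ Λ, if liftCfg Λ' r a x - r = 0 then (1 : ℝ) else 0 :=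
    .prod fun x _ => by
      simpa only [liftCfg, add_sub_cancel_left] using isGinibre_indicator_zero (fieldAt q Λ' x)
  have hcorr := (hF Λ').correlation hI (isGinibre_neg_ham (α := α) hJ hβ hφ Λ' r)
  rw [div_le_div_iff₀]
  · rwa [mul_comm (∑ a, F _ * _ * _)]
  · exact Finset.sum_pos (fun _ _ => Real.exp_pos _) Finset.univ_nonempty
  · refine Finset.sum_pos' (fun a _ => mul_nonneg (Finset.prod_nonneg fun x _ => ?_)
      (Real.exp_pos _).le) ⟨0, Finset.mem_univ _, mul_pos (Finset.prod_pos fun x _ => ?_)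
      (Real.exp_pos _)⟩
    · split_ifs <;> norm_num
    · simp [liftCfg]

theorem neg_one_le_gibbsMean {F : (Zd d → ZMod q) → ℝ} (hF : ∀ σ, -1 ≤ F σ)
    (Λ : Finset (Zd d)) : -1 ≤ gibbsMean J α β φ Λ r F := by
  rw [gibbsMean_eq_div,
    le_div_iff₀ (Finset.sum_pos (fun _ _ => Real.exp_pos _) Finset.univ_nonempty),
    Finset.mul_sum]
  exact Finset.sum_le_sum fun σ _ => mul_le_mul_of_nonneg_right (hF _) (Real.exp_pos _).le

/-- The character of the spins on `Λ₀`, measured relative to `r`, with frequency `k`. -/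
def spinChar {Λ₀ : Finset (Zd d)} (r : ZMod q) (k : Λ₀ → ZMod q) (σ : Zd d → ZMod q) : ℂ :=
  ZMod.stdAddChar (∑ x, k x * (σ x - r))

theorem isGinibre_re_spinChar {Λ₀ : Finset (Zd d)} (k : Λ₀ → ZMod q) (Λ : Finset (Zd d)) :
    IsGinibre fun a : Λ → ZMod (2 * q) => (spinChar r k (liftCfg Λ r a)).re := by
  convert isGinibre_stdAddChar (∑ x : Λ₀,
    (AddMonoidHom.mulLeft ((k x).val : ZMod (2 * q))).comp (fieldAt q Λ x)) using 4 with a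
  simp [spinChar, liftCfg, AddMonoidHom.finsetSum_apply, map_sum]

theorem gibbsMean_im_spinChar (hφ : ∀ n, φ (-n) = φ n) {Λ₀ : Finset (Zd d)}
    (k : Λ₀ → ZMod q) (Λ : Finset (Zd d)) :
    gibbsMean J α β φ Λ r (fun σ => (spinChar r k σ).im) = 0 := by
  rw [gibbsMean_eq_div_lift]
  refine div_eq_zero_iff.2 (.inl ?_)
  rw [← self_eq_neg, ← Finset.sum_neg_distrib]
  refine Fintype.sum_equiv (Equiv.neg _) _ _ fun a => ?_
  have h : spinChar r k (liftCfg Λ r (-a)) = starRingEnd ℂ (spinChar r k (liftCfg Λ r a)) := by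
    simp [spinChar, liftCfg, ← stdAddChar_neg]
  simp [ham_liftCfg_neg hφ, h]

theorem tendsto_gibbsMean_re_spinChar (hα : (d : ℝ) < α) (hJ : 0 ≤ J) (hβ : 0 ≤ β)
    (hφ : ∀ k, 0 ≤ (ftZMod φ k).re ∧ (ftZMod φ k).im = 0) {Λ₀ : Finset (Zd d)}
    (k : Λ₀ → ZMod q) :
    ∃ L, Tendsto (fun Λ => gibbsMean J α β φ Λ r fun σ => (spinChar r k σ).re) atTop
      (nhds L) := by
  refine ⟨_, tendsto_atTop_ciInf
    (antitone_gibbsMean hα hJ hβ hφ (isGinibre_re_spinChar k)) ⟨-1, ?_⟩⟩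
  rintro _ ⟨Λ, rfl⟩
  refine neg_one_le_gibbsMean (fun σ => ?_) Λ
  have h := Complex.abs_re_le_norm (spinChar r k σ)
  rw [spinChar, AddChar.norm_apply] at h
  exact (abs_le.1 h).1

theorem sum_stdAddChar_eq_ite {ι : Type*} [Fintype ι] [DecidableEq ι] (t : ι → ZMod q) :
    ∑ k : ι → ZMod q, (ZMod.stdAddChar (∑ x, k x * t x) : ℂ) =
      if t = 0 then (q : ℂ) ^ Fintype.card ι else 0 := by
  have h := Finset.prod_univ_sum (fun _ : ι => (Finset.univ : Finset (ZMod q)))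
    fun x j => (ZMod.stdAddChar (j * t x) : ℂ)
  rw [Fintype.piFinset_univ] at h
  have hprod (k : ι → ZMod q) : (ZMod.stdAddChar (∑ x, k x * t x) : ℂ) =
      ∏ x, (ZMod.stdAddChar (k x * t x) : ℂ) :=
    map_prod (ZMod.stdAddChar (N := q)).toMonoidHom
      (fun x => Multiplicative.ofAdd (k x * t x)) Finset.univ
  simp only [hprod]
  rw [← h]
  simp only [AddChar.sum_mulShift _ (ZMod.isPrimitive_stdAddChar q), ZMod.card]
  split_ifs with ht
  · simp [ht]
  · obtain ⟨x, hx⟩ := Function.ne_iff.1 ht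
    exact Finset.prod_eq_zero (Finset.mem_univ x) (by simp [show t x ≠ 0 from hx])

/-- Fourier expansion of a local function. -/
theorem exists_eq_sum_spinChar {f : (Zd d → ZMod q) → ℝ} {Λ₀ : Finset (Zd d)}
    (hloc : ∀ σ τ : Zd d → ZMod q, (∀ x ∈ Λ₀, σ x = τ x) → f σ = f τ) (r : ZMod q) :
    ∃ c : (Λ₀ → ZMod q) → ℂ, ∀ σ, f σ =
      ∑ k, ((c k).re * (spinChar r k σ).re - (c k).im * (spinChar r k σ).im) := by
  classical
  refine ⟨fun k => ((q : ℂ) ^ Fintype.card Λ₀)⁻¹ * ∑ η : Λ₀ → ZMod q,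
    f (extendCfg Λ₀ r η) * ZMod.stdAddChar (∑ x, k x * (r - η x)), fun σ => ?_⟩
  simp only [← Complex.mul_re, ← Complex.re_sum]
  rw [← Complex.ofReal_re (f σ)]
  congr 1
  have hq : (q : ℂ) ^ Fintype.card Λ₀ ≠ 0 := pow_ne_zero _ (by exact_mod_cast NeZero.ne q)
  simp only [mul_assoc, Finset.sum_mul, ← Finset.mul_sum]
  rw [Finset.sum_comm, eq_inv_mul_iff_mul_eq₀ hq]
  have h (η : Λ₀ → ZMod q) : ∑ k : Λ₀ → ZMod q, (f (extendCfg Λ₀ r η) : ℂ) *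
      (ZMod.stdAddChar (∑ x, k x * (r - η x)) * spinChar r k σ) =
      if (fun x : Λ₀ => σ x) = η then
        (f (extendCfg Λ₀ r η) : ℂ) * (q : ℂ) ^ Fintype.card Λ₀ else 0 := by
    have := sum_stdAddChar_eq_ite fun x : Λ₀ => σ x - η x
    have hiff : (fun x : Λ₀ => σ x - η x) = 0 ↔ (fun x : Λ₀ => σ x) = η := by
      simp [funext_iff, sub_eq_zero]
    rw [← Finset.mul_sum, ← mul_ite_zero, ← if_congr hiff rfl rfl, ← this]
    congr 1
    refine Finset.sum_congr rfl fun k _ => ?_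
    rw [spinChar, ← AddChar.map_add_eq_mul, ← Finset.sum_add_distrib]
    congr 1
    exact Finset.sum_congr rfl fun x _ => by ring
  simp only [h, Finset.sum_ite_eq, Finset.mem_univ, if_true]
  rw [mul_comm, hloc σ (extendCfg Λ₀ r fun x => σ x) fun x hx => by simp [extendCfg, hx]]

end Mean

/-- **Existence of the thermodynamic limit of expectations of local functions**
(Corollary 2.13): if `φ` has nonnegative Fourier transform, then for every local
function `f` and every monochromatic boundary condition `r`, the net
`Λ ↦ ⟨f⟩^r_{Λ,β}` converges. -/
theorem thermodynamic_limit_local_function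
    (d q : ℕ) (hd : 2 ≤ d) [NeZero q] (hq : 2 ≤ q)
    (α J β : ℝ) (hα : (d : ℝ) < α) (hJ : 0 < J) (hβ : 0 < β)
    (φ : ZMod q → ℝ) (hφ : ∀ k : ZMod q, 0 ≤ (ftZMod φ k).re ∧ (ftZMod φ k).im = 0)
    (f : (Zd d → ZMod q) → ℝ) (Λ₀ : Finset (Zd d))
    (hloc : ∀ σ τ : Zd d → ZMod q, (∀ x ∈ Λ₀, σ x = τ x) → f σ = f τ)
    (r : ZMod q) :
    ∃ L : ℝ, Tendsto
      (fun Λ : Finset (Zd d) =>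
        ∑ σ : Λ → ZMod q, f (extendCfg Λ r σ) * gibbsWeight d q J α β φ Λ r σ)
      atTop (nhds L) := by
  have hφ' : ∀ n, φ (-n) = φ n := even_of_ftZMod_real fun k => (hφ k).2
  obtain ⟨c, hc⟩ := exists_eq_sum_spinChar hloc r
  choose L hL using fun k : Λ₀ → ZMod q =>
    tendsto_gibbsMean_re_spinChar (r := r) hα hJ.le hβ.le hφ k
  refine ⟨∑ k, (c k).re * L k,
    (tendsto_finsetSum Finset.univ fun k _ => (hL k).const_mul (c k).re).congr fun Λ => ?_⟩
  have him (k : Λ₀ → ZMod q) :=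
    gibbsMean_im_spinChar (J := J) (α := α) (β := β) (r := r) hφ' k Λ
  have hsub (k : Λ₀ → ZMod q) :
      (c k).re * gibbsMean J α β φ Λ r (fun σ => (spinChar r k σ).re) =
      (c k).re * gibbsMean J α β φ Λ r (fun σ => (spinChar r k σ).re) -
        (c k).im * gibbsMean J α β φ Λ r (fun σ => (spinChar r k σ).im) := by
    rw [him, mul_zero, sub_zero]
  rw [Finset.sum_congr rfl fun k _ => hsub k]
  simp only [gibbsMean, Finset.mul_sum, ← Finset.sum_sub_distrib]
  rw [Finset.sum_comm]
  refine Finset.sum_congr rfl fun σ _ => ?_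
  rw [hc, Finset.sum_mul]
  exact Finset.sum_congr rfl fun k _ => by ring
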